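/- Let A be a symmetric n×n real matrix with n ≥ 3 that is Robinsonian. Let τ_1 be a good SFS ordering of A and, for each i with 2 ≤ i ≤ n-2, let τ_i be an SFS_+ ordering of A with respect to τ_{i-1}. Then τ_{n-2} is a Robinson ordering of A. -/

import Mathlib

/-- `π` is a Robinson ordering of the symmetric matrix `A`: entries are monotone
nondecreasing towards the diagonal. Here `π x` is the position of vertex `x`. -/
def IsRobinsonOrdering {n : ℕ} (A : Matrix (Fin n) (Fin n) ℝ)
    (π : Equiv.Perm (Fin n)) : Prop :=
  ∀ x y z : Fin n, π x < π y → π y < π z → A x z ≤ min (A x y) (A y z)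

/-- `A` is Robinsonian: it admits a Robinson ordering. -/
def IsRobinsonian {n : ℕ} (A : Matrix (Fin n) (Fin n) ℝ) : Prop :=
  ∃ π : Equiv.Perm (Fin n), IsRobinsonOrdering A π

/-- There is a path from `x` to `z` avoiding `y`: a sequence `x = v 0, v 1, ..., v k = z`
with `A (v i) (v (i+1)) > min (A y (v i)) (A y (v (i+1)))` for all `i < k`. -/
def PathAvoiding {n : ℕ} (A : Matrix (Fin n) (Fin n) ℝ) (x y z : Fin n) : Prop :=
  ∃ (k : ℕ) (v : ℕ → Fin n), v 0 = x ∧ v k = z ∧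
    ∀ i < k, min (A y (v i)) (A y (v (i + 1))) < A (v i) (v (i + 1))

/-- `z` is valid: for no pair of distinct vertices `u, v ≠ z` there exist both a path
from `u` to `z` avoiding `v` and a path from `v` to `z` avoiding `u`. -/
def IsValid {n : ℕ} (A : Matrix (Fin n) (Fin n) ℝ) (z : Fin n) : Prop :=
  ∀ u v : Fin n, u ≠ v → u ≠ z → v ≠ z →
    ¬ (PathAvoiding A u v z ∧ PathAvoiding A v u z)

/-- `a` is the first element of the linear order `π`. -/
def IsFirstOf {n : ℕ} (π : Equiv.Perm (Fin n)) (a : Fin n) : Prop :=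
  ∀ y : Fin n, π a ≤ π y

/-- `a` is the last element of the linear order `π`. -/
def IsLastOf {n : ℕ} (π : Equiv.Perm (Fin n)) (a : Fin n) : Prop :=
  ∀ y : Fin n, π y ≤ π a

/-- `a` is an anchor of `A`: some Robinson ordering of `A` ends with `a`. -/
def IsAnchor {n : ℕ} (A : Matrix (Fin n) (Fin n) ℝ) (a : Fin n) : Prop :=
  ∃ π : Equiv.Perm (Fin n), IsRobinsonOrdering A π ∧ IsLastOf π a

/-- `a, b` are opposite anchors of `A`: some Robinson ordering starts with `a` and
ends with `b`. -/
def OppositeAnchors {n : ℕ} (A : Matrix (Fin n) (Fin n) ℝ) (a b : Fin n) : Prop :=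
  ∃ π : Equiv.Perm (Fin n), IsRobinsonOrdering A π ∧ IsFirstOf π a ∧ IsLastOf π b

/-- `σ` is an SFS ordering of `A` (3-point characterization): whenever
`x <_σ y <_σ z` and `A x z > A x y`, some `u <_σ x` has `A u y > A u z`. -/
def IsSFSOrdering {n : ℕ} (A : Matrix (Fin n) (Fin n) ℝ)
    (σ : Equiv.Perm (Fin n)) : Prop :=
  ∀ x y z : Fin n, σ x < σ y → σ y < σ z → A x y < A x z →
    ∃ u : Fin n, σ u < σ x ∧ A u z < A u y

/-- `σ` is an SFS₊ ordering of `A` with respect to `τ`: it is an SFS ordering and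
ties are broken according to `τ` (whenever `y <_σ z` are tied, `z <_τ y`). -/
def IsSFSPlus {n : ℕ} (A : Matrix (Fin n) (Fin n) ℝ)
    (τ σ : Equiv.Perm (Fin n)) : Prop :=
  IsSFSOrdering A σ ∧
    ∀ y z : Fin n, σ y < σ z → (∀ u : Fin n, σ u < σ y → A u y = A u z) → τ z < τ y

/-- `σ` is a good SFS ordering of `A`: it is an SFS ordering whose first element is
the last element of some SFS ordering of `A`. -/
def IsGoodSFS {n : ℕ} (A : Matrix (Fin n) (Fin n) ℝ)
    (σ : Equiv.Perm (Fin n)) : Prop :=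
  IsSFSOrdering A σ ∧
    ∃ b : Fin n, IsFirstOf σ b ∧ ∃ τ : Equiv.Perm (Fin n), IsSFSOrdering A τ ∧ IsLastOf τ b

/-- The union `L_0 ∪ L_1 ∪ ... ∪ L_i` of the similarity layers of `A` rooted at `a`. -/
def simLayerUnion {n : ℕ} (A : Matrix (Fin n) (Fin n) ℝ) (a : Fin n) : ℕ → Set (Fin n)
  | 0 => {a}
  | i + 1 => simLayerUnion A a i ∪
      {y | y ∉ simLayerUnion A a i ∧
        ∀ x ∈ simLayerUnion A a i, ∀ z ∉ simLayerUnion A a i, A x z ≤ A x y}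

/-- The `i`th similarity layer `L_i` of `A` rooted at `a`: `L_0 = {a}` and
`L_{i+1} = {y ∉ L_0 ∪ ... ∪ L_i : A x y ≥ A x z for all x ∈ L_0 ∪ ... ∪ L_i and
z ∉ L_0 ∪ ... ∪ L_i}`. -/
def simLayer {n : ℕ} (A : Matrix (Fin n) (Fin n) ℝ) (a : Fin n) : ℕ → Set (Fin n)
  | 0 => {a}
  | i + 1 => {y | y ∉ simLayerUnion A a i ∧
      ∀ x ∈ simLayerUnion A a i, ∀ z ∉ simLayerUnion A a i, A x z ≤ A x y}

namespace SFSProof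

set_option linter.unusedSectionVars false

variable {V : Type} [DecidableEq V]

def Rob (A : V → V → ℝ) (S : Finset V) (f : V → ℤ) : Prop :=
  (∀ x ∈ S, ∀ y ∈ S, f x = f y → x = y) ∧
  ∀ x ∈ S, ∀ y ∈ S, ∀ z ∈ S, f x < f y → f y < f z → A x z ≤ A x y ∧ A x z ≤ A y z

def SFS (A : V → V → ℝ) (S : Finset V) (f : V → ℤ) : Prop :=
  (∀ x ∈ S, ∀ y ∈ S, f x = f y → x = y) ∧
  ∀ x ∈ S, ∀ y ∈ S, ∀ z ∈ S, f x < f y → f y < f z → A x y < A x z →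
    ∃ u ∈ S, f u < f x ∧ A u z < A u y

def SFSP (A : V → V → ℝ) (S : Finset V) (t s : V → ℤ) : Prop :=
  SFS A S s ∧ ∀ y ∈ S, ∀ z ∈ S, s y < s z → (∀ u ∈ S, s u < s y → A u y = A u z) → t z < t y

/-- some Robinson ordering starts with `a` -/
def Anch (A : V → V → ℝ) (S : Finset V) (a : V) : Prop :=
  ∃ f, Rob A S f ∧ ∀ y ∈ S, f a ≤ f y

theorem Rob.neg {A : V → V → ℝ} (hA : ∀ x y, A x y = A y x) {S : Finset V} {f : V → ℤ}
    (h : Rob A S f) : Rob A S (fun v => - f v) := by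
  refine ⟨fun x hx y hy e => h.1 x hx y hy (by simpa using e), ?_⟩
  intro x hx y hy z hz h1 h2
  have := h.2 z hz y hy x hx (by simpa using h2) (by simpa using h1)
  rw [hA x z, hA x y, hA y z]
  exact ⟨this.2, this.1⟩

theorem Rob.mono {A : V → V → ℝ} {S T : Finset V} (hT : T ⊆ S) {f : V → ℤ}
    (h : Rob A S f) : Rob A T f :=
  ⟨fun x hx y hy => h.1 x (hT hx) y (hT hy),
   fun x hx y hy z hz => h.2 x (hT hx) y (hT hy) z (hT hz)⟩

theorem bound (S : Finset V) (f : V → ℤ) : ∃ N : ℤ, ∀ v ∈ S, |f v| < N := by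
  refine ⟨∑ v ∈ S, |f v| + 1, fun v hv => ?_⟩
  have := Finset.single_le_sum (f := fun v => |f v|) (fun i _ => abs_nonneg _) hv
  omega

/-- gluing Robinson orders -/
theorem asm {A : V → V → ℝ} (hA : ∀ x y, A x y = A y x) (S P I : Finset V) (p r : V → ℤ)
    (c : V → ℝ) (hPS : P ⊆ S)
    (hp : Rob A P p) (hr : Rob A (S \ P) r)
    (hI : I ⊆ S \ P)
    (hIdown : ∀ x ∈ I, ∀ w ∈ S \ P, w ∉ I → r x < r w)
    (hc : ∀ q ∈ P, ∀ y ∈ S \ P, A q y = c q)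
    (h2 : ∀ q ∈ P, ∀ x ∈ I, ∀ w ∈ S \ P, w ∉ I → A x w ≤ c q)
    (h3 : ∀ q ∈ P, ∀ x ∈ I, ∀ y ∈ I, x ≠ y → c q ≤ A x y)
    (h3' : ∀ q ∈ P, ∀ x ∈ S \ P, ∀ y ∈ S \ P, x ∉ I → y ∉ I → x ≠ y → c q ≤ A x y)
    (h4 : I.Nonempty → ∀ y ∈ P, ∀ z ∈ P, p y < p z → c z ≤ c y ∧ c z ≤ A y z)
    (h5 : (∃ w ∈ S \ P, w ∉ I) → ∀ y ∈ P, ∀ z ∈ P, p y < p z → c y ≤ c z ∧ c y ≤ A y z)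
    (b : V) (hb : b ∈ S \ P) (hbI : b ∉ I) (hbl : ∀ w ∈ S \ P, r w ≤ r b) :
    ∃ g, Rob A S g ∧ ∀ y ∈ S, g y ≤ g b := by
  obtain ⟨N, hN⟩ := bound S p
  obtain ⟨M, hM⟩ := bound S r
  have hN' : ∀ v ∈ S, p v < N ∧ -N < p v := fun v hv => by have := abs_lt.1 (hN v hv); omega
  have hM' : ∀ v ∈ S, r v < M ∧ -M < r v := fun v hv => by have := abs_lt.1 (hM v hv); omega
  have hN0 : 0 < N := lt_of_le_of_lt (abs_nonneg _) (hN b (Finset.mem_sdiff.1 hb).1)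
  have hM0 : 0 < M := lt_of_le_of_lt (abs_nonneg _) (hM b (Finset.mem_sdiff.1 hb).1)
  let g : V → ℤ := fun v => if v ∈ P then p v else if v ∈ I then r v - N - M else r v + N + M
  have gP : ∀ v ∈ P, g v = p v := fun v hv => by simp [g, hv]
  have gI : ∀ v ∈ I, g v = r v - N - M := fun v hv => by
    have := Finset.mem_sdiff.1 (hI hv)
    simp [g, hv, this.2]
  have gZ : ∀ v ∈ S \ P, v ∉ I → g v = r v + N + M := fun v hv hv' => by
    have := Finset.mem_sdiff.1 hv
    simp [g, hv', this.2]
  have tri : ∀ v ∈ S, (v ∈ P ∧ g v = p v ∧ g v < N ∧ -N < g v) ∨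
      (v ∈ I ∧ v ∈ S \ P ∧ g v = r v - N - M ∧ g v < -N) ∨
      (v ∉ I ∧ v ∈ S \ P ∧ g v = r v + N + M ∧ N < g v) := by
    intro v hv
    have a1 := hN' v hv
    have a2 := hM' v hv
    by_cases h : v ∈ P
    · left; have := gP v h; refine ⟨h, this, ?_, ?_⟩ <;> omega
    · have h' : v ∈ S \ P := Finset.mem_sdiff.2 ⟨hv, h⟩
      by_cases hi : v ∈ I
      · right; left; have := gI v hi; refine ⟨hi, h', this, ?_⟩; omega
      · right; right; have := gZ v h' hi; refine ⟨hi, h', this, ?_⟩; omega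
  clear_value g
  refine ⟨g, ⟨?_, ?_⟩, ?_⟩
  · intro x hx y hy e
    rcases tri x hx with ⟨x1, x2, x3, x4⟩ | ⟨x1, x2, x3, x4⟩ | ⟨x1, x2, x3, x4⟩ <;>
    rcases tri y hy with ⟨y1, y2, y3, y4⟩ | ⟨y1, y2, y3, y4⟩ | ⟨y1, y2, y3, y4⟩ <;>
    first
    | (exfalso; omega)
    | exact hp.1 x x1 y y1 (by omega)
    | exact hr.1 x x2 y y2 (by omega)
  · intro x hx y hy z hz l1 l2
    have nxy : x ≠ y := by rintro rfl; omega
    have nyz : y ≠ z := by rintro rfl; omega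
    rcases tri x hx with ⟨x1, x2, x3, x4⟩ | ⟨x1, x2, x3, x4⟩ | ⟨x1, x2, x3, x4⟩ <;>
    rcases tri y hy with ⟨y1, y2, y3, y4⟩ | ⟨y1, y2, y3, y4⟩ | ⟨y1, y2, y3, y4⟩ <;>
    rcases tri z hz with ⟨z1, z2, z3, z4⟩ | ⟨z1, z2, z3, z4⟩ | ⟨z1, z2, z3, z4⟩ <;>
    first
    | (exfalso; omega)
    | exact hp.2 x x1 y y1 z z1 (by omega) (by omega)
    | exact hr.2 x x2 y y2 z z2 (by omega) (by omega)
    | (have := hr.2 x x2 y y2 z z2 (by omega) (by have := hIdown y y1 z z2 z1; omega); exact this)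
    | (have := hr.2 x x2 y y2 z z2 (by have := hIdown x x1 y y2 y1; omega) (by omega); exact this)
    | (rw [hc x x1 z z2, hc y y1 z z2]; exact (h5 ⟨z, z2, z1⟩ x x1 y y1 (by omega)).symm)
    | (rw [hc x x1 z z2, hc x x1 y y2]; exact ⟨le_rfl, h3' x x1 y y2 z z2 y1 z1 nyz⟩)
    | (rw [hA x z, hA x y, hc z z1 x x2, hc y y1 x x2]; exact h4 ⟨x, x1⟩ y y1 z z1 (by omega))
    | (rw [hA x z, hA y z, hc z z1 x x2, hc z z1 y y2]; exact ⟨h3 z z1 x x1 y y1 nxy, le_rfl⟩)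
    | (rw [hA x y, hc y y1 x x2, hc y y1 z z2]; exact ⟨h2 y y1 x x1 z z2 z1, h2 y y1 x x1 z z2 z1⟩)
  · intro y hy
    have hbS := (Finset.mem_sdiff.1 hb).1
    rcases tri b hbS with ⟨x1, x2, x3, x4⟩ | ⟨x1, x2, x3, x4⟩ | ⟨x1, x2, x3, x4⟩
    · exact absurd x1 (Finset.mem_sdiff.1 hb).2
    · exact absurd x1 hbI
    rcases tri y hy with ⟨y1, y2, y3, y4⟩ | ⟨y1, y2, y3, y4⟩ | ⟨y1, y2, y3, y4⟩
    · omega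
    · omega
    · have := hbl y y2; omega

/-- existence of the homogeneous prefix -/
theorem exP {A : V → V → ℝ} (hA : ∀ x y, A x y = A y x) (S : Finset V) (p s : V → ℤ)
    (hp : Rob A S p) (hs : SFS A S s) (b : V) (hb : b ∈ S) (hbl : ∀ y ∈ S, s y ≤ s b)
    (hcard : 2 ≤ S.card) :
    ∃ P ⊆ S, P.Nonempty ∧ b ∉ P ∧ (∀ x ∈ P, ∀ y ∈ S, y ∉ P → s x < s y) ∧
      (∀ x ∈ P, ∀ z ∈ P, ∀ y ∈ S, p x < p y → p y < p z → y ∈ P) ∧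
      (∀ q ∈ P, ∀ y ∈ S, y ∉ P → A q y = A q b) := by
  classical
  let F : Finset (Finset V) := S.powerset.filter (fun P => P.Nonempty ∧ b ∉ P ∧
      (∀ x ∈ P, ∀ y ∈ S, y ∉ P → s x < s y) ∧
      (∀ x ∈ P, ∀ z ∈ P, ∀ y ∈ S, p x < p y → p y < p z → y ∈ P))
  have hF : F.Nonempty := by
    obtain ⟨a, ha, hmin⟩ := Finset.exists_min_image S s ⟨b, hb⟩
    refine ⟨{a}, ?_⟩
    simp only [F, Finset.mem_filter, Finset.mem_powerset]
    refine ⟨by simpa using ha, ⟨a, by simp⟩, ?_, ?_, ?_⟩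
    · intro h
      have e : b = a := by simpa using h
      obtain ⟨x, hx, y, hy, hxy⟩ := Finset.one_lt_card.1 hcard
      apply hxy
      have := hmin x hx; have := hmin y hy; have := hbl x hx; have := hbl y hy
      subst e
      exact hs.1 x hx y hy (by omega)
    · intro x hx y hy hya
      have e : x = a := by simpa using hx
      subst e
      have n : y ≠ x := by simpa using hya
      have := hmin y hy
      rcases lt_or_eq_of_le this with h | h
      · exact h
      · exact absurd (hs.1 _ ha _ hy h).symm n
    · intro x hx z hz y hy
      have e : x = a := by simpa using hx
      have e : z = a := by simpa using hz
      subst x z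
      intro h1 h2; omega
  obtain ⟨P, hPF, hmax⟩ := Finset.exists_max_image F Finset.card hF
  have hPF' := hPF
  simp only [F, Finset.mem_filter, Finset.mem_powerset] at hPF
  obtain ⟨hPS, hne, hbP, hpre, hconv⟩ := hPF
  refine ⟨P, hPS, hne, hbP, hpre, hconv, ?_⟩
  by_contra hcon
  push Not at hcon
  obtain ⟨q, hq, y0, hy0, hy0P, hqy0⟩ := hcon
  let P' : Finset V := S.filter (fun y => y ∈ P ∨ ∃ q ∈ P, A q y ≠ A q b)
  have memP' : ∀ y, y ∈ P' ↔ y ∈ S ∧ (y ∈ P ∨ ∃ q ∈ P, A q y ≠ A q b) := by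
    intro y; simp [P']
  have nP' : ∀ y ∈ S, y ∉ P' → y ∉ P ∧ ∀ q ∈ P, A q y = A q b := by
    intro y hy h; rw [memP'] at h; push Not at h; exact h hy
  have hsub : P ⊂ P' := by
    rw [Finset.ssubset_iff_of_subset]
    · exact ⟨y0, (memP' y0).2 ⟨hy0, Or.inr ⟨q, hq, hqy0⟩⟩, hy0P⟩
    · intro v hv; exact (memP' v).2 ⟨hPS hv, Or.inl hv⟩
  have : P' ∈ F := by
    simp only [F, Finset.mem_filter, Finset.mem_powerset]
    refine ⟨Finset.filter_subset _ _, hne.mono hsub.1, ?_, ?_, ?_⟩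
    · rw [memP']; rintro ⟨-, h | ⟨q, hq, h⟩⟩
      · exact hbP h
      · exact h rfl
    · intro y hy z hz hzP'
      obtain ⟨hzP, hzb⟩ := nP' z hz hzP'
      obtain ⟨hyS, h⟩ := (memP' y).1 hy
      by_cases hyP : y ∈ P
      · exact hpre y hyP z hz hzP
      have h := h.resolve_left hyP
      by_contra hlt
      have hzy : s z < s y := by
        rcases lt_trichotomy (s z) (s y) with h | h | h
        · exact h
        · rw [hs.1 z hz y hyS h] at hzP'; exact absurd hy hzP'
        · exact absurd h hlt
      obtain ⟨w, hw, hwy⟩ := h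
      obtain ⟨u, hu, humin⟩ := Finset.exists_min_image (P.filter (fun q => A q y ≠ A q b)) s
        ⟨w, by simp [hw, hwy]⟩
      simp only [Finset.mem_filter] at hu humin
      have hum : ∀ v ∈ S, s v < s u → A v y = A v b := by
        intro v hv hvu
        by_contra hne
        have hvP : v ∈ P := by
          by_contra hh
          have := hpre u hu.1 v hv hh; omega
        have := humin v ⟨hvP, hne⟩; omega
      have hub := hpre u hu.1 y hyS hyP
      have huz := hpre u hu.1 z hz hzP
      rcases lt_or_gt_of_ne hu.2 with h | h
      · have hyb : s y < s b := by
          rcases lt_or_eq_of_le (hbl y hyS) with h' | h'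
          · exact h'
          · rw [hs.1 y hyS b hb h'] at h; exact absurd h (lt_irrefl _)
        obtain ⟨v, hv, hvu, hlt⟩ := hs.2 u (hPS hu.1) y hyS b hb hub hyb h
        rw [hum v hv hvu] at hlt; exact lt_irrefl _ hlt
      · rw [← hzb u hu.1] at h
        obtain ⟨v, hv, hvu, hlt⟩ := hs.2 u (hPS hu.1) z hz y hyS huz hzy h
        have hvP : v ∈ P := by
          by_contra hh
          have := hpre u hu.1 v hv hh; omega
        rw [hum v hv hvu, hzb v hvP] at hlt; exact lt_irrefl _ hlt
    · intro x hx z hz y hy hxy hyz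
      by_contra hyP'
      obtain ⟨hyP, hyb⟩ := nP' y hy hyP'
      -- an element which is dominated cannot be distinguished
      have key : ∀ x ∈ P', x ∉ P → (∀ q ∈ P, A q x ≤ A q y) → False := by
        intro x hx hxP hle
        obtain ⟨hxS, h⟩ := (memP' x).1 hx
        obtain ⟨w, hw, hwx⟩ := h.resolve_left hxP
        have h1 : A w x < A w b := lt_of_le_of_ne (by rw [← hyb w hw]; exact hle w hw) hwx
        have hxb : s x < s b := by
          rcases lt_or_eq_of_le (hbl x hxS) with h' | h'
          · exact h'
          · rw [hs.1 x hxS b hb h'] at h1; exact absurd h1 (lt_irrefl _)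
        obtain ⟨v, hv, hvu, hlt⟩ := hs.2 w (hPS hw) x hxS b hb (hpre w hw x hxS hxP) hxb h1
        have hvP : v ∈ P := by
          by_contra hh
          have := hpre w hw v hv hh; omega
        have := hle v hvP
        rw [hyb v hvP] at this
        linarith
      obtain ⟨q0, hq0⟩ := hne
      have hxS := ((memP' x).1 hx).1
      have hzS := ((memP' z).1 hz).1
      have hq0y : p q0 ≠ p y := fun h => by
        rw [hp.1 q0 (hPS hq0) y hy h] at hq0; exact hyP hq0
      rcases lt_or_gt_of_ne hq0y with h | h
      · have hall : ∀ q ∈ P, p q < p y := by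
          intro q hq
          have hqy : p q ≠ p y := fun h => by
            rw [hp.1 q (hPS hq) y hy h] at hq; exact hyP hq
          by_contra hh
          exact hyP (hconv q0 hq0 q hq y hy h (by omega))
        refine key z hz (fun hzP => by have := hall z hzP; omega) ?_
        intro q hq
        exact (hp.2 q (hPS hq) y hy z hzS (hall q hq) hyz).1
      · have hall : ∀ q ∈ P, p y < p q := by
          intro q hq
          have hqy : p q ≠ p y := fun h => by
            rw [hp.1 q (hPS hq) y hy h] at hq; exact hyP hq
          by_contra hh
          exact hyP (hconv q hq q0 hq0 y hy (by omega) h)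
        refine key x hx (fun hxP => by have := hall x hxP; omega) ?_
        intro q hq
        rw [hA q x, hA q y]
        exact (hp.2 x hxS y hy q (hPS hq) hxy (hall q hq)).2
  have h1 := hmax P' this
  have h2 := Finset.card_lt_card hsub
  omega

theorem endAnchor {A : V → V → ℝ} (hA : ∀ x y, A x y = A y x) (k : ℕ) :
    ∀ (S : Finset V), S.card ≤ k → ∀ (p s : V → ℤ),
    Rob A S p → SFS A S s → ∀ b ∈ S, (∀ y ∈ S, s y ≤ s b) →
    ∃ g, Rob A S g ∧ ∀ y ∈ S, g y ≤ g b := by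
  induction k with
  | zero =>
    intro S hS p s _ _ b hb
    have : S = ∅ := by simpa using hS
    subst this; simp at hb
  | succ k ih =>
    intro S hS p s hp hs b hb hbl
    by_cases hcard : 2 ≤ S.card
    swap
    · refine ⟨p, hp, fun y hy => ?_⟩
      have : y = b := Finset.card_le_one.1 (by omega) y hy b hb
      rw [this]
    obtain ⟨P, hPS, hne, hbP, hpre, hconv, hhom⟩ := exP hA S p s hp hs b hb hbl hcard
    have hcl : (S \ P).card ≤ k := by
      have := Finset.card_sdiff_add_card_eq_card hPS
      have := Finset.card_pos.2 hne
      omega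
    have hbB : b ∈ S \ P := Finset.mem_sdiff.2 ⟨hb, hbP⟩
    have hsB : SFS A (S \ P) s := by
      refine ⟨fun x hx y hy => hs.1 x (Finset.sdiff_subset hx) y (Finset.sdiff_subset hy), ?_⟩
      intro x hx y hy z hz h1 h2 h3
      obtain ⟨u, hu, hux, hlt⟩ := hs.2 x (Finset.sdiff_subset hx) y (Finset.sdiff_subset hy) z
        (Finset.sdiff_subset hz) h1 h2 h3
      refine ⟨u, Finset.mem_sdiff.2 ⟨hu, fun huP => ?_⟩, hux, hlt⟩
      rw [Finset.mem_sdiff] at hy hz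
      rw [hhom u huP y hy.1 hy.2, hhom u huP z hz.1 hz.2] at hlt
      exact lt_irrefl _ hlt
    obtain ⟨r, hr, hrl⟩ := ih (S \ P) hcl p s (hp.mono Finset.sdiff_subset) hsB b hbB
      (fun y hy => hbl y (Finset.sdiff_subset hy))
    have hhom' : ∀ q ∈ P, ∀ y ∈ S \ P, A q y = A q b := fun q hq y hy =>
      hhom q hq y (Finset.mem_sdiff.1 hy).1 (Finset.mem_sdiff.1 hy).2
    -- the final gluing, for any Robinson ordering `p`
    have side : ∀ p, Rob A S p →
        (∀ x ∈ P, ∀ z ∈ P, ∀ y ∈ S, p x < p y → p y < p z → y ∈ P) →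
        ∀ w ∈ S \ P, (∀ q ∈ P, p w < p q) ∨ (∀ q ∈ P, p q < p w) := by
      intro p hp hconv w hw
      rw [Finset.mem_sdiff] at hw
      have hneq : ∀ q ∈ P, p q ≠ p w := fun q hq h => by
        rw [hp.1 q (hPS hq) w hw.1 h] at hq; exact hw.2 hq
      by_contra hcon
      push Not at hcon
      obtain ⟨⟨q, hq, h1⟩, ⟨q', hq', h2⟩⟩ := hcon
      have := hneq q hq
      have := hneq q' hq'
      exact hw.2 (hconv q hq q' hq' w hw.1 (by omega) (by omega))
    by_cases hC : ∀ q ∈ P, ∀ y ∈ S \ P, ∀ z ∈ S \ P, y ≠ z → A q b ≤ A y z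
    · have fin : ∀ p, Rob A S p → (∀ q ∈ P, p q < p b) →
          ∃ g, Rob A S g ∧ ∀ y ∈ S, g y ≤ g b := by
        intro p hp hpb
        refine asm hA S P ∅ p r (fun q => A q b) hPS (hp.mono hPS) hr (by simp) (by simp) hhom'
          (by simp) (by simp) ?_ (by simp) ?_ b hbB (by simp) hrl
        · intro q hq x hx y hy _ _ hn; exact hC q hq x hx y hy hn
        · intro _ y hy z hz hyz
          exact (hp.2 y (hPS hy) z (hPS hz) b hb hyz (hpb z hz)).symm
      rcases side p hp hconv b hbB with h | h
      · exact fin _ (hp.neg hA) (fun q hq => by have := h q hq; omega)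
      · exact fin _ hp h
    · push Not at hC
      obtain ⟨q, hq, y, hy, z, hz, hyz, hlt⟩ := hC
      obtain ⟨y0, hy0, hy0min⟩ := Finset.exists_min_image (S \ P) r ⟨b, hbB⟩
      have hy0b : A y0 b < A q b ∧ y0 ≠ b := by
        have aux : ∀ y ∈ S \ P, ∀ z ∈ S \ P, r y < r z → A y0 b ≤ A y z ∧ y0 ≠ b := by
          intro y hy z hz h
          have a1 := hy0min y hy
          have a2 := hrl z hz
          refine ⟨?_, fun e => by rw [e] at a1; omega⟩
          have b1 : A y0 b ≤ A y b := by
            rcases lt_or_eq_of_le a1 with h1 | h1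
            · exact (hr.2 y0 hy0 y hy b hbB h1 (by omega)).2
            · rw [hr.1 _ hy0 _ hy h1]
          have b2 : A y b ≤ A y z := by
            rcases lt_or_eq_of_le a2 with h1 | h1
            · exact (hr.2 y hy z hz b hbB h h1).1
            · rw [hr.1 _ hz _ hbB h1]
          exact b1.trans b2
        rcases lt_trichotomy (r y) (r z) with h | h | h
        · have := aux y hy z hz h; exact ⟨this.1.trans_lt hlt, this.2⟩
        · exact absurd (hr.1 _ hy _ hz h) hyz
        · have := aux z hz y hy h; rw [hA z y] at this; exact ⟨this.1.trans_lt hlt, this.2⟩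
      have fin : ∀ p, Rob A S p →
          (∀ x ∈ P, ∀ z ∈ P, ∀ y ∈ S, p x < p y → p y < p z → y ∈ P) →
          (∀ q ∈ P, p y0 < p q) →
          ∃ g, Rob A S g ∧ ∀ y ∈ S, g y ≤ g b := by
        intro p hp hconv hpy0
        have side := side p hp hconv
        have sub : ∀ v ∈ S \ P, v ∈ S := fun v hv => Finset.sdiff_subset hv
        -- same side
        have sameL : ∀ q ∈ P, ∀ x ∈ S \ P, ∀ y ∈ S \ P, x ≠ y → p x < p q → p y < p q →
            A q b ≤ A x y := by
          intro q hq x hx y hy hxy h1 h2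
          rcases lt_trichotomy (p x) (p y) with h | h | h
          · have := (hp.2 x (sub x hx) y (sub y hy) q (hPS hq) h h2).1
            rwa [hA x q, hhom' q hq x hx] at this
          · exact absurd (hp.1 _ (sub x hx) _ (sub y hy) h) hxy
          · have := (hp.2 y (sub y hy) x (sub x hx) q (hPS hq) h h1).1
            rwa [hA y q, hhom' q hq y hy, hA y x] at this
        have sameR : ∀ q ∈ P, ∀ x ∈ S \ P, ∀ y ∈ S \ P, x ≠ y → p q < p x → p q < p y →
            A q b ≤ A x y := by
          intro q hq x hx y hy hxy h1 h2
          rcases lt_trichotomy (p x) (p y) with h | h | h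
          · have := (hp.2 q (hPS hq) x (sub x hx) y (sub y hy) h1 h).2
            rwa [hhom' q hq y hy] at this
          · exact absurd (hp.1 _ (sub x hx) _ (sub y hy) h) hxy
          · have := (hp.2 q (hPS hq) y (sub y hy) x (sub x hx) h2 h).2
            rwa [hhom' q hq x hx, hA y x] at this
        have hbR : ∀ q ∈ P, p q < p b := by
          rcases side b hbB with h | h
          · exfalso
            have := sameL q hq y0 hy0 b hbB hy0b.2 (hpy0 q hq) (h q hq)
            linarith [hy0b.1]
          · exact h
        have ceq : ∀ y ∈ P, ∀ z ∈ P, p y < p z → A y b = A z b ∧ A y b ≤ A y z := by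
          intro y hy z hz h
          have e1 := hp.2 y0 (sub _ hy0) y (hPS hy) z (hPS hz) (hpy0 y hy) h
          have e2 := hp.2 y (hPS hy) z (hPS hz) b hb h (hbR z hz)
          rw [hA y0 z, hA y0 y, hhom' z hz y0 hy0, hhom' y hy y0 hy0] at e1
          exact ⟨le_antisymm e2.2 e1.1, e2.1⟩
        have call : ∀ y ∈ P, ∀ z ∈ P, A y b = A z b := by
          intro y hy z hz
          rcases lt_trichotomy (p y) (p z) with h | h | h
          · exact (ceq y hy z hz h).1
          · rw [hp.1 _ (hPS hy) _ (hPS hz) h]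
          · exact (ceq z hz y hy h).1.symm
        classical
        let I : Finset V := (S \ P).filter
          (fun w => ∀ w' ∈ S \ P, r w' ≤ r w → ∀ q ∈ P, p w' < p q)
        have mI : ∀ w, w ∈ I ↔ w ∈ S \ P ∧ ∀ w' ∈ S \ P, r w' ≤ r w → ∀ q ∈ P, p w' < p q := by
          intro w; simp only [I, Finset.mem_filter]
        have nI : ∀ w ∈ S \ P, w ∉ I → ∃ q ∈ S \ P, r q ≤ r w ∧ ∀ t ∈ P, p t < p q := by
          intro w hw h
          rw [mI] at h
          push Not at h
          obtain ⟨v, hv, hvw, t, ht, htv⟩ := h hw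
          refine ⟨v, hv, hvw, ?_⟩
          rcases side v hv with h | h
          · have := h t ht; omega
          · exact h
        clear_value I
        have Idown : ∀ x ∈ I, ∀ w ∈ S \ P, (∀ t ∈ P, p t < p w) → r x < r w := by
          intro x hx w hw h
          by_contra hh
          have a := ((mI x).1 hx).2 w hw (by omega) q hq
          have := h q hq
          omega
        have IL : ∀ x ∈ I, ∀ t ∈ P, p x < p t := fun x hx => ((mI x).1 hx).2 x ((mI x).1 hx).1 le_rfl
        refine asm hA S P I p r (fun q => A q b) hPS (hp.mono hPS) hr
          (fun v hv => ((mI v).1 hv).1) ?_ hhom' ?_ ?_ ?_ ?_ ?_ b hbB ?_ hrl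
        · intro x hx w hw hwI
          obtain ⟨v, hv, hvw, h⟩ := nI w hw hwI
          have := Idown x hx v hv h
          omega
        · intro t ht x hx w hw hwI
          obtain ⟨v, hv, hvw, h⟩ := nI w hw hwI
          have hxv := Idown x hx v hv h
          have hxS := ((mI x).1 hx).1
          have c1 : A x w ≤ A x v := by
            rcases lt_or_eq_of_le hvw with h1 | h1
            · exact (hr.2 x hxS v hv w hw hxv h1).1
            · rw [hr.1 _ hv _ hw h1]
          have c2 := (hp.2 x (sub x hxS) t (hPS ht) v (sub v hv) (IL x hx t ht) (h t ht)).2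
          rw [hhom' t ht v hv] at c2
          exact c1.trans c2
        · intro t ht x hx y hy hxy
          exact sameL t ht x ((mI x).1 hx).1 y ((mI y).1 hy).1 hxy (IL x hx t ht) (IL y hy t ht)
        · intro t ht
          have half : ∀ x ∈ S \ P, ∀ y ∈ S \ P, x ∉ I → r x < r y → A t b ≤ A x y := by
            intro x hx y hy hxI h
            have hyb := hrl y hy
            have d1 : A x b ≤ A x y := by
              rcases lt_or_eq_of_le hyb with h1 | h1
              · exact (hr.2 x hx y hy b hbB h h1).1
              · rw [hr.1 _ hy _ hbB h1]
            by_contra hcon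
            push Not at hcon
            have d2 : A x b < A t b := lt_of_le_of_lt d1 hcon
            apply hxI
            rw [mI]
            refine ⟨hx, fun w hw hwx => ?_⟩
            have d3 : A w b ≤ A x b := by
              rcases lt_or_eq_of_le hwx with h1 | h1
              · exact (hr.2 w hw x hx b hbB h1 (by omega)).2
              · rw [hr.1 _ hw _ hx h1]
            rcases side w hw with h1 | h1
            · exact h1
            · exfalso
              have hwb : w ≠ b := fun e => by rw [e] at hwx; omega
              have := sameR t ht w hw b hbB hwb (h1 t ht) (hbR t ht)
              linarith
          intro x hx y hy hxI hyI hxy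
          rcases lt_trichotomy (r x) (r y) with h | h | h
          · exact half x hx y hy hxI h
          · exact absurd (hr.1 _ hx _ hy h) hxy
          · rw [hA x y]; exact half y hy x hx hyI h
        · intro _ y hy z hz h
          have := ceq y hy z hz h
          exact ⟨this.1.ge, this.1 ▸ this.2⟩
        · intro _ y hy z hz h
          have := ceq y hy z hz h
          exact ⟨this.1.le, this.2⟩
        · intro hbI
          have := IL b hbI q hq
          have := hbR q hq
          omega
      rcases side p hp hconv y0 hy0 with h | h
      · exact fin p hp hconv h
      · refine fin _ (hp.neg hA) ?_ (fun q hq => by have := h q hq; omega)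
        intro x hx z hz y hy h1 h2
        exact hconv z hz x hx y hy (by omega) (by omega)

/-- layers rooted at the set `H` -/
def Lay (A : V → V → ℝ) (S : Finset V) (H : V → Prop) : ℕ → V → Prop
  | 0 => H
  | i + 1 => fun v => Lay A S H i v ∨
      (v ∈ S ∧ ∀ x, Lay A S H i x → ∀ z ∈ S, ¬ Lay A S H i z → A x z ≤ A x v)

/-- `H` is a prefix of `s` inside `S` -/
def Pref (S : Finset V) (H : V → Prop) (s : V → ℤ) : Prop :=
  (∀ v, H v → v ∈ S) ∧ ∀ y z, H y → z ∈ S → ¬ H z → s y < s z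

theorem Lay.memS {A : V → V → ℝ} {S : Finset V} {H : V → Prop} (ha : ∀ v, H v → v ∈ S) :
    ∀ i v, Lay A S H i v → v ∈ S := by
  intro i
  induction i with
  | zero => exact ha
  | succ i ih =>
    rintro v (h | h)
    · exact ih v h
    · exact h.1

theorem Lay.mono {A : V → V → ℝ} {S : Finset V} {H : V → Prop} {i j : ℕ} (h : i ≤ j) (v : V) 
    (hv : Lay A S H i v) : Lay A S H j v := by
  induction h with
  | refl => exact hv
  | step _ ih => exact Or.inl ih

theorem Lay.prefSFS {A : V → V → ℝ} {S : Finset V} {H : V → Prop} (ha : ∀ v, H v → v ∈ S) {s : V → ℤ}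
    (hs : SFS A S s) (hfirst : Pref S H s) :
    ∀ i y z, Lay A S H i y → z ∈ S → ¬ Lay A S H i z → s y < s z := by
  intro i
  induction i with
  | zero => exact hfirst.2
  | succ i ih =>
    intro y z hy hz hnz
    have hyS := Lay.memS ha _ _ hy
    have hzi : ¬ Lay A S H i z := fun h => hnz (Or.inl h)
    by_cases hyi : Lay A S H i y
    · exact ih y z hyi hz hzi
    have hy' := (Or.resolve_left hy hyi).2
    have hnz' : ¬ (∀ x, Lay A S H i x → ∀ w ∈ S, ¬ Lay A S H i w → A x w ≤ A x z) :=
      fun h => hnz (Or.inr ⟨hz, h⟩)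
    push Not at hnz'
    obtain ⟨x, hx, w, hw, hwi, hlt⟩ := hnz'
    by_contra hcon
    have hzy : s z < s y := by
      rcases lt_or_eq_of_le (not_lt.1 hcon) with h | h
      · exact h
      · rw [hs.1 _ hz _ hyS h] at hnz; exact absurd hy hnz
    have h1 : A x z < A x y := hlt.trans_le (hy' x hx w hw hwi)
    have hxS := Lay.memS ha _ _ hx
    obtain ⟨u, hu, hux, hlt2⟩ := hs.2 x hxS z hz y hyS (ih x z hx hz hzi) hzy h1
    have hui : Lay A S H i u := by
      by_contra hh
      have := ih x u hx hu hh; omega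
    have := hy' u hui z hz hzi
    linarith

theorem Rob.toSFS {A : V → V → ℝ} {S : Finset V} {f : V → ℤ} (h : Rob A S f) : SFS A S f :=
  ⟨h.1, fun x hx y hy z hz h1 h2 h3 => by
    have := (h.2 x hx y hy z hz h1 h2).1; linarith⟩

theorem Lay.exhaust {A : V → V → ℝ} {S : Finset V} {H : V → Prop} (ha : ∀ v, H v → v ∈ S)
    {p : V → ℤ} (hp : Rob A S p) (hfirst : Pref S H p) (K : ℤ) (hK : ∀ v ∈ S, K < p v) :
    ∀ (i : ℕ), ∀ v ∈ S, p v ≤ K + i → Lay A S H i v := by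
  intro i
  induction i with
  | zero =>
    intro v hv h
    have := hK v hv
    push_cast at h; omega
  | succ i ih =>
    intro v hv h
    by_cases hvi : Lay A S H i v
    · exact Or.inl hvi
    refine Or.inr ⟨hv, fun x hx z hz hzi => ?_⟩
    have hxv := Lay.prefSFS ha hp.toSFS hfirst i x v hx hv hvi
    have hvz : p v ≤ p z := by
      by_contra hh
      exact hzi (ih z hz (by push_cast at h; omega))
    rcases lt_or_eq_of_le hvz with h1 | h1
    · exact (hp.2 x (Lay.memS ha _ _ hx) v hv z hz hxv h1).1
    · rw [hp.1 _ hv _ hz h1]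

theorem Lay.ex {A : V → V → ℝ} {S : Finset V} {H : V → Prop} (ha : ∀ v, H v → v ∈ S) {p : V → ℤ}
    (hp : Rob A S p) (hfirst : Pref S H p) (v : V) (hv : v ∈ S) :
    H v ∨ ∃ i, ¬ Lay A S H i v ∧ Lay A S H (i + 1) v := by
  classical
  obtain ⟨N, hN⟩ := bound S p
  obtain ⟨K, hK⟩ : ∃ K : ℤ, ∀ v ∈ S, K < p v :=
    ⟨-N, fun v hv => (abs_lt.1 (hN v hv)).1⟩
  have hex : ∃ i, Lay A S H i v :=
    ⟨(p v - K).toNat, Lay.exhaust ha hp hfirst K hK _ v hv (by omega)⟩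
  have h1 := Nat.find_spec hex
  have h2 := fun m => Nat.find_min (m := m) hex
  rcases hN' : Nat.find hex with _ | i
  · left; rw [hN'] at h1; exact h1
  · right; rw [hN'] at h1; exact ⟨i, h2 i (by omega), h1⟩

theorem Lay.same {A : V → V → ℝ} {S : Finset V} {H : V → Prop} {i : ℕ} {x u z : V} 
    (hx : Lay A S H i x) (hu : ¬ Lay A S H i u) (hu' : Lay A S H (i + 1) u)
    (hz : ¬ Lay A S H i z) (hz' : Lay A S H (i + 1) z) : A x u = A x z := by
  have h1 := (Or.resolve_left hu' hu)
  have h2 := (Or.resolve_left hz' hz)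
  exact le_antisymm (h2.2 x hx u h1.1 hu) (h1.2 x hx z h2.1 hz)

theorem layC {A : V → V → ℝ} (hA : ∀ x y, A x y = A y x) {S : Finset V} {H : V → Prop} (ha : ∀ v, H v → v ∈ S)
    {p t s : V → ℤ}
    (hp : Rob A S p) (hpf : Pref S H p) (ht : SFS A S t) (htf : Pref S H t)
    (hs : SFSP A S t s) :
    ∀ i y z, Lay A S H i y → z ∈ S → ¬ Lay A S H i z → s z < s y := by
  classical
  by_contra hcon
  push Not at hcon
  obtain ⟨i0, y1, z1, hy1, hz1, hz1', hle1⟩ := hcon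
  obtain ⟨y, hy, hymin⟩ := Finset.exists_min_image (S.filter (fun y => ∃ i z, Lay A S H i y ∧ z ∈ S ∧
    ¬ Lay A S H i z ∧ s y ≤ s z)) s ⟨y1, by
      simp only [Finset.mem_filter]; exact ⟨Lay.memS ha _ _ hy1, i0, z1, hy1, hz1, hz1', hle1⟩⟩
  simp only [Finset.mem_filter] at hy hymin
  obtain ⟨hyS, i, z, hyi, hz, hzi, hle⟩ := hy
  have hne : y ≠ z := by rintro rfl; exact hzi hyi
  have hlt : s y < s z := lt_of_le_of_ne hle (fun h => hne (hs.1.1 _ hyS _ hz h))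
  have htyz := Lay.prefSFS ha ht htf i y z hyi hz hzi
  have hpyz := Lay.prefSFS ha hp.toSFS hpf i y z hyi hz hzi
  have hnt : ∃ u ∈ S, s u < s y ∧ A u y ≠ A u z := by
    by_contra hh
    push Not at hh
    have := hs.2 y hyS z hz hlt hh
    omega
  obtain ⟨u0, hu0S, hu0⟩ := hnt
  obtain ⟨u, hu, humin⟩ := Finset.exists_min_image
    (S.filter (fun u => s u < s y ∧ A u y ≠ A u z)) s ⟨u0, by simp [hu0S, hu0]⟩
  simp only [Finset.mem_filter] at hu humin
  obtain ⟨huS, huy, hune⟩ := hu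
  have hgt : A u z < A u y := by
    by_contra hh
    have h1 : A u y < A u z := lt_of_le_of_ne (not_lt.1 hh) hune
    obtain ⟨v, hv, hvu, h2⟩ := hs.1.2 u huS y hyS z hz huy hlt h1
    have := humin v ⟨hv, by omega, h2.ne'⟩
    omega
  have hpuz : p u < p z := by
    by_contra hh
    have : p z < p u := lt_of_le_of_ne (not_lt.1 hh) (fun h => by
      have := hp.1 _ hz _ huS h; subst this; omega)
    have := (hp.2 y hyS z hz u huS hpyz this).2
    rw [hA y u, hA z u] at this
    linarith
  -- u and z lie in the same layer
  have hsame : ∀ j, Lay A S H j u ↔ Lay A S H j z := by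
    intro j
    constructor
    · intro h
      by_contra hh
      have := hymin u ⟨huS, j, z, h, hz, hh, by omega⟩
      omega
    · intro h
      by_contra hh
      have := Lay.prefSFS ha hp.toSFS hpf j z u h huS hh
      omega
  rcases Lay.ex ha hp hpf z hz with h | ⟨j, hj, hj'⟩
  · exact hzi (Lay.mono (Nat.zero_le i) _ h)
  have hij : i ≤ j := by
    by_contra hh
    exact hzi (Lay.mono (by omega) _ hj')
  have e := Lay.same (Lay.mono hij y hyi) (fun h => hj ((hsame j).1 h)) ((hsame (j+1)).2 hj') hj hj'
  -- A y u = A y z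
  rcases lt_trichotomy (p y) (p u) with h | h | h
  · have := (hp.2 y hyS u huS z hz h hpuz).2
    rw [hA y u] at e
    linarith
  · have := hp.1 _ hyS _ huS h; subst this; omega
  · have hui : ¬ Lay A S H i u := fun h => hzi ((hsame i).1 h)
    have := Lay.prefSFS ha hp.toSFS hpf i y u hyi huS hui
    omega

theorem layLast {A : V → V → ℝ} (hA : ∀ x y, A x y = A y x) {S : Finset V} {a : V} (ha : a ∈ S)
    {p t s : V → ℤ}
    (hp : Rob A S p) (hpf : ∀ y ∈ S, p a ≤ p y) (ht : SFS A S t) (htf : ∀ y ∈ S, t a ≤ t y)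
    (hs : SFSP A S t s) :
    (∀ y ∈ S, s y ≤ s a) ∧
      ∀ y ∈ S, ∀ z ∈ S, y ≠ a → z ≠ a → A a z < A a y → s z < s y := by
  have hH : ∀ v, v = a → v ∈ S := by rintro v rfl; exact ha
  have pf : ∀ f : V → ℤ, (∀ x ∈ S, ∀ y ∈ S, f x = f y → x = y) → (∀ y ∈ S, f a ≤ f y) →
      Pref S (· = a) f := by
    intro f hinj hf
    refine ⟨hH, ?_⟩
    rintro y z rfl hz hzy
    exact lt_of_le_of_ne (hf z hz) (fun e => hzy (hinj _ ha _ hz e).symm)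
  have hpf := pf p hp.1 hpf
  have htf := pf t ht.1 htf
  have C := layC hA hH hp hpf ht htf hs
  constructor
  · intro y hy
    by_cases h : y = a
    · rw [h]
    · exact (C 0 a y rfl hy h).le
  · intro y hy z hz hya hza hlt
    obtain ⟨i, hi, hi'⟩ := (Lay.ex hH hp hpf y hy).resolve_left hya
    have haL : ∀ i, Lay A S (· = a) i a := fun i => Lay.mono (Nat.zero_le i) _ rfl
    by_cases hzi' : Lay A S (· = a) (i + 1) z
    · exfalso
      by_cases hzi : Lay A S (· = a) i z
      · have h1 := Lay.prefSFS hH hp.toSFS hpf i z y hzi hy hi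
        have h2 := Lay.prefSFS hH hp.toSFS hpf 0 a z rfl hz hza
        have := (hp.2 a ha z hz y hy h2 h1).1
        linarith
      · have := Lay.same (haL i) hi hi' hzi hzi'
        linarith
    · exact C (i+1) y z hi' hz hzi'

theorem plusFirst {A : V → V → ℝ} {S : Finset V} {a : V} (ha : a ∈ S) {t s : V → ℤ}
    (htl : ∀ y ∈ S, t y ≤ t a) (hs : SFSP A S t s) : ∀ y ∈ S, s a ≤ s y := by
  obtain ⟨m, hm, hmin⟩ := Finset.exists_min_image S s ⟨a, ha⟩
  by_cases h : m = a
  · rw [← h]; exact hmin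
  · exfalso
    have hlt : s m < s a := lt_of_le_of_ne (hmin a ha) (fun e => h (hs.1.1 _ hm _ ha e))
    have h1 := hs.2 m hm a ha hlt (fun u hu hum => by have := hmin u hu; omega)
    have := htl m hm
    omega

theorem erase_last {A : V → V → ℝ} {S : Finset V} {a : V} {s : V → ℤ}
    (hl : ∀ y ∈ S, s y ≤ s a) (hs : SFS A S s) : SFS A (S.erase a) s := by
  refine ⟨fun x hx y hy => hs.1 x (Finset.mem_of_mem_erase hx) y (Finset.mem_of_mem_erase hy), ?_⟩
  intro x hx y hy z hz h1 h2 h3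
  have hxS := (Finset.mem_of_mem_erase hx)
  obtain ⟨u, hu, hux, h4⟩ := hs.2 x hxS y (Finset.mem_of_mem_erase hy) z
    (Finset.mem_of_mem_erase hz) h1 h2 h3
  refine ⟨u, Finset.mem_erase.2 ⟨?_, hu⟩, hux, h4⟩
  rintro rfl
  have := hl x hxS; omega

theorem erase_last_plus {A : V → V → ℝ} {S : Finset V} {a : V} {t s : V → ℤ}
    (hl : ∀ y ∈ S, s y ≤ s a) (hs : SFSP A S t s) : SFSP A (S.erase a) t s := by
  refine ⟨erase_last hl hs.1, ?_⟩
  intro y hy z hz h1 h2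
  refine hs.2 y (Finset.mem_of_mem_erase hy) z (Finset.mem_of_mem_erase hz) h1 ?_
  intro u hu huy
  refine h2 u (Finset.mem_erase.2 ⟨?_, hu⟩) huy
  rintro rfl
  have := hl y (Finset.mem_of_mem_erase hy); omega

/-- monotonicity of the row of the first element -/
theorem first_row {A : V → V → ℝ} {S : Finset V} {a : V} (ha : a ∈ S) {s : V → ℤ}
    (hf : ∀ y ∈ S, s a ≤ s y) (hs : SFS A S s) :
    ∀ y ∈ S, ∀ z ∈ S, y ≠ a → z ≠ a → s y < s z → A a z ≤ A a y := by
  intro y hy z hz hya hza h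
  by_contra hh
  have h1 : s a < s y := lt_of_le_of_ne (hf y hy) (fun e => hya (hs.1 _ ha _ hy e).symm)
  obtain ⟨u, hu, hua, _⟩ := hs.2 a ha y hy z hz h1 h (not_le.1 hh)
  have := hf u hu
  omega

theorem splitKey {A : V → V → ℝ} (hA : ∀ x y, A x y = A y x)
    {S : Finset V} {a : V} (ha : a ∈ S) {p t s : V → ℤ}
    (hp : Rob A S p) (hpf : ∀ y ∈ S, p a ≤ p y)
    (hf : ∀ y ∈ S, s a ≤ s y) (ht : SFS A S t) (htl : ∀ y ∈ S, t y ≤ t a) (hs : SFSP A S t s)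
    (hC : ∀ y ∈ S, ∀ z ∈ S, y ≠ a → z ≠ a → A a z < A a y → t z < t y) :
    ∀ u ∈ S, ∀ y ∈ S, ∀ z ∈ S, u ≠ a → y ≠ a → z ≠ a → s u < s y → A a z < A a y →
      A u z ≤ A u y := by
  intro u hu y hy z hz hua hya hza huy h
  have h1 := first_row ha hf hs.1 u hu y hy hua hya huy
  have lt : ∀ w ∈ S, w ≠ a → p a < p w := fun w hw hwa =>
    lt_of_le_of_ne (hpf w hw) (fun e => hwa (hp.1 _ ha _ hw e).symm)
  have ord : ∀ z ∈ S, z ≠ a → ∀ w ∈ S, w ≠ a → A a z < A a w → p w < p z := by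
    intro z hz hza w hw hwa h
    by_contra hh
    rcases lt_or_eq_of_le (not_lt.1 hh) with h' | h'
    · have := (hp.2 a ha z hz w hw (lt z hz hza) h').1; linarith
    · rw [hp.1 _ hz _ hw h'] at h; exact absurd h (lt_irrefl _)
  have o1 := ord z hz hza u hu hua (h.trans_le h1)
  have o2 := ord z hz hza y hy hya h
  rcases lt_trichotomy (p u) (p y) with h' | h' | h'
  · exact (hp.2 u hu y hy z hz h' o2).1
  · have := hp.1 _ hu _ hy h'; subst this; omega
  have h3 := hp.2 y hy u hu z hz h' o1
  by_contra hcon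
  push Not at hcon
  let H : V → Prop := fun v => v ∈ S ∧ v ≠ a ∧ A a v < A a y
  have hH : ∀ v, H v → v ∈ S := fun v hv => hv.1
  have hPt : Pref S H t := by
    refine ⟨hH, ?_⟩
    rintro v w ⟨hv, hva, hvy⟩ hw hwH
    by_cases hwa : w = a
    · subst hwa
      exact lt_of_le_of_ne (htl v hv) (fun e => hva (ht.1 _ hv _ hw e))
    · have : A a y ≤ A a w := by
        by_contra hh; exact hwH ⟨hw, hwa, not_le.1 hh⟩
      exact hC w hw v hv hwa hva (by linarith)
  have hPp : Pref S H (fun v => - p v) := by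
    refine ⟨hH, ?_⟩
    rintro v w ⟨hv, hva, hvy⟩ hw hwH
    by_cases hwa : w = a
    · subst hwa
      have := lt v hv hva
      exact neg_lt_neg this
    · have : A a y ≤ A a w := by
        by_contra hh; exact hwH ⟨hw, hwa, not_le.1 hh⟩
      have := ord v hv hva w hw hwa (by linarith)
      exact neg_lt_neg this
  have C := layC hA hH (hp.neg hA) hPp ht hPt hs
  have huH : ¬ H u := fun hh => by have := hh.2.2; linarith
  have hyH : ¬ H y := fun hh => lt_irrefl _ hh.2.2
  have hzH : H z := ⟨hz, hza, h⟩
  obtain ⟨i, hi, hi'⟩ := (Lay.ex hH (hp.neg hA) hPp u hu).resolve_left huH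
  by_cases hyi : Lay A S H i y
  · have := Lay.prefSFS hH (hp.neg hA).toSFS hPp i y u hyi hu hi
    omega
  by_cases hyi' : Lay A S H (i + 1) y
  · have e := Lay.same (Lay.mono (A := A) (S := S) (H := H) (Nat.zero_le i) z hzH) hi hi' hyi hyi'
    rw [hA z u, hA z y] at e
    rw [hA u y] at hcon
    linarith [h3.1]
  · have := C (i + 1) u y hi' hy hyi'
    omega

theorem erase_first_plus {A : V → V → ℝ} (hA : ∀ x y, A x y = A y x)
    {S : Finset V} {a : V} (ha : a ∈ S) {p t s : V → ℤ}
    (hp : Rob A S p) (hpf : ∀ y ∈ S, p a ≤ p y)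
    (hf : ∀ y ∈ S, s a ≤ s y) (ht : SFS A S t) (htl : ∀ y ∈ S, t y ≤ t a) (hs : SFSP A S t s)
    (hC : ∀ y ∈ S, ∀ z ∈ S, y ≠ a → z ≠ a → A a z < A a y → t z < t y) :
    SFSP A (S.erase a) t s := by
  have key := splitKey hA ha hp hpf hf ht htl hs hC
  refine ⟨⟨fun x hx y hy =>
    hs.1.1 x (Finset.mem_of_mem_erase hx) y (Finset.mem_of_mem_erase hy), ?_⟩, ?_⟩
  · intro x hx y hy z hz h1 h2 h3
    rw [Finset.mem_erase] at hx hy hz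
    obtain ⟨u, hu, hux, h4⟩ := hs.1.2 x hx.2 y hy.2 z hz.2 h1 h2 h3
    refine ⟨u, Finset.mem_erase.2 ⟨?_, hu⟩, hux, h4⟩
    rintro rfl
    have := key x hx.2 y hy.2 z hz.2 hx.1 hy.1 hz.1 h1 h4
    linarith
  · intro y hy z hz h1 h2
    rw [Finset.mem_erase] at hy hz
    have h3 := first_row ha hf hs.1 y hy.2 z hz.2 hy.1 hz.1 h1
    rcases lt_or_eq_of_le h3 with h4 | h4
    · exact hC y hy.2 z hz.2 hy.1 hz.1 h4
    · refine hs.2 y hy.2 z hz.2 h1 ?_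
      intro u hu huy
      by_cases hua : u = a
      · rw [hua, h4]
      · exact h2 u (Finset.mem_erase.2 ⟨hua, hu⟩) huy

/-- if the row of the first element is monotone, the Robinson property extends -/
theorem extend {A : V → V → ℝ} (hA : ∀ x y, A x y = A y x)
    {S : Finset V} {a : V} (ha : a ∈ S) {p s : V → ℤ}
    (hp : Rob A S p) (hpf : ∀ y ∈ S, p a ≤ p y)
    (hinj : ∀ x ∈ S, ∀ y ∈ S, s x = s y → x = y)
    (hf : ∀ y ∈ S, s a ≤ s y)
    (hmono : ∀ y ∈ S, ∀ z ∈ S, y ≠ a → z ≠ a → s y < s z → A a z ≤ A a y)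
    (hR : Rob A (S.erase a) s) : Rob A S s := by
  refine ⟨hinj, ?_⟩
  intro x hx y hy z hz h1 h2
  have hya : y ≠ a := by rintro rfl; have := hf x hx; omega
  have hza : z ≠ a := by rintro rfl; have := hf x hx; omega
  by_cases hxa : x = a
  · subst hxa
    have m := hmono y hy z hz hya hza h2
    refine ⟨m, ?_⟩
    have lt : ∀ w ∈ S, w ≠ x → p x < p w := fun w hw hwa =>
      lt_of_le_of_ne (hpf w hw) (fun e => hwa (hp.1 _ hx _ hw e).symm)
    rcases lt_trichotomy (p y) (p z) with h' | h' | h'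
    · exact (hp.2 x hx y hy z hz (lt y hy hya) h').2
    · have := hp.1 _ hy _ hz h'; subst this; omega
    · have := (hp.2 x hx z hz y hy (lt z hz hza) h').2
      rw [hA y z]; linarith
  · exact hR.2 x (Finset.mem_erase.2 ⟨hxa, hx⟩) y (Finset.mem_erase.2 ⟨hya, hy⟩) z
      (Finset.mem_erase.2 ⟨hza, hz⟩) h1 h2

theorem main {A : V → V → ℝ} (hA : ∀ x y, A x y = A y x) (k : ℕ) :
    ∀ (S : Finset V), S.card = k + 3 → ∀ (τ : ℕ → V → ℤ) (p : V → ℤ) (a : V), a ∈ S →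
    Rob A S p → (∀ y ∈ S, p a ≤ p y) → SFS A S (τ 0) → (∀ y ∈ S, τ 0 a ≤ τ 0 y) →
    (∀ i < k, SFSP A S (τ i) (τ (i + 1))) → Rob A S (τ k) := by
  induction k with
  | zero =>
    intro S hS τ p a ha hp hpf h0 h0f _
    refine extend hA ha hp hpf h0.1 h0f (first_row ha h0f h0) ⟨?_, ?_⟩
    · exact fun x hx y hy => h0.1 x (Finset.mem_of_mem_erase hx) y (Finset.mem_of_mem_erase hy)
    · intro x hx y hy z hz h1 h2
      exfalso
      have c : (S.erase a).card = 2 := by rw [Finset.card_erase_of_mem ha]; omega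
      have : 2 < (S.erase a).card := Finset.two_lt_card.2 ⟨x, hx, y, hy, z, hz, by
        rintro rfl; omega, by rintro rfl; omega, by rintro rfl; omega⟩
      omega
  | succ k ih =>
    intro S hS τ p a ha hp hpf h0 h0f hstep
    have hSFS : ∀ i ≤ k + 1, SFS A S (τ i) := by
      intro i hi
      rcases i with _ | i
      · exact h0
      · exact (hstep i (by omega)).1
    have E : ∀ i ≤ k + 1, (∀ y ∈ S, τ i a ≤ τ i y) ∨ ((∀ y ∈ S, τ i y ≤ τ i a) ∧
        ∀ y ∈ S, ∀ z ∈ S, y ≠ a → z ≠ a → A a z < A a y → τ i z < τ i y) := by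
      intro i
      induction i with
      | zero => intro _; exact Or.inl h0f
      | succ i ihi =>
        intro hi
        rcases ihi (by omega) with h | h
        · exact Or.inr (layLast hA ha hp hpf (hSFS i (by omega)) h (hstep i (by omega)))
        · exact Or.inl (plusFirst ha h.1 (hstep i (by omega)))
    obtain ⟨b, hb, hbmax⟩ := Finset.exists_max_image S (τ 0) ⟨a, ha⟩
    have hba : b ≠ a := by
      rintro rfl
      obtain ⟨x, hx, y, hy, hxy⟩ := Finset.one_lt_card.1 (show 1 < S.card by omega)
      apply hxy
      have := hbmax x hx; have := hbmax y hy; have := h0f x hx; have := h0f y hy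
      exact h0.1 x hx y hy (by omega)
    obtain ⟨g, hg, hgb⟩ := endAnchor hA S.card S le_rfl p (τ 0) hp h0 b hb hbmax
    have hsub : S.erase a ⊆ S := Finset.erase_subset _ _
    have h1l := layLast hA ha hp hpf h0 h0f (hstep 0 (by omega))
    have IH := ih (S.erase a) (by rw [Finset.card_erase_of_mem ha]; omega) (fun i => τ (i + 1))
      (fun v => - g v) b (Finset.mem_erase.2 ⟨hba, hb⟩) ((hg.neg hA).mono hsub)
      (fun y hy => by have := hgb y (hsub hy); simpa using this)
      (erase_last h1l.1 (hSFS 1 (by omega)))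
      (fun y hy => plusFirst hb hbmax (hstep 0 (by omega)) y (hsub hy))
      (by
        intro i hi
        have st := hstep (i + 1) (by omega)
        rcases E (i + 1) (by omega) with h | h
        · exact erase_last_plus (layLast hA ha hp hpf (hSFS (i+1) (by omega)) h st).1 st
        · exact erase_first_plus hA ha hp hpf (plusFirst ha h.1 st) (hSFS (i+1) (by omega))
            h.1 st h.2)
    have hk := hSFS (k + 1) le_rfl
    rcases E (k + 1) le_rfl with h | h
    · exact extend hA ha hp hpf hk.1 h (first_row ha h hk) IH
    · have := extend hA ha hp hpf (s := fun v => - τ (k + 1) v)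
        (fun x hx y hy e => hk.1 x hx y hy (by simpa using e))
        (fun y hy => by have := h.1 y hy; simpa using this)
        (fun y hy z hz hya hza hlt => by
          by_contra hh
          have := h.2 z hz y hy hza hya (not_le.1 hh)
          omega)
        (IH.neg hA)
      simpa using this.neg hA

end SFSProof

/-- If `A` is a symmetric Robinsonian `n × n` matrix with `n ≥ 3`, `τ 1`
is a good SFS ordering of `A`, and for each `2 ≤ i ≤ n - 2` the ordering `τ i` is an
SFS₊ ordering of `A` with respect to `τ (i-1)`, then `τ (n-2)` is a Robinson ordering
of `A`. -/
theorem stmt_19 {n : ℕ} (hn : 3 ≤ n) (A : Matrix (Fin n) (Fin n) ℝ) (hA : A.IsSymm)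
    (hRob : IsRobinsonian A)
    (τ : ℕ → Equiv.Perm (Fin n)) (h1 : IsGoodSFS A (τ 1))
    (hstep : ∀ i : ℕ, 2 ≤ i → i ≤ n - 2 → IsSFSPlus A (τ (i - 1)) (τ i)) :
    IsRobinsonOrdering A (τ (n - 2)) := by
  classical
  have hA' : ∀ x y, A x y = A y x := fun x y => hA.apply y x
  let e : Equiv.Perm (Fin n) → Fin n → ℤ := fun σ v => ((σ v : ℕ) : ℤ)
  have elt : ∀ σ x y, e σ x < e σ y ↔ σ x < σ y := by
    intro σ x y; simp only [e, Nat.cast_lt, Fin.val_fin_lt]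
  have ele : ∀ σ x y, e σ x ≤ e σ y ↔ σ x ≤ σ y := by
    intro σ x y; simp only [e, Nat.cast_le, Fin.val_fin_le]
  have einj : ∀ σ, ∀ x ∈ (Finset.univ : Finset (Fin n)), ∀ y ∈ (Finset.univ : Finset (Fin n)),
      e σ x = e σ y → x = y := by
    intro σ x _ y _ h
    have h : ((σ x : ℕ) : ℤ) = ((σ y : ℕ) : ℤ) := h
    exact σ.injective (Fin.ext (by exact_mod_cast h))
  have eSFS : ∀ σ, IsSFSOrdering A σ → SFSProof.SFS A Finset.univ (e σ) := by
    intro σ h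
    refine ⟨einj σ, ?_⟩
    intro x _ y _ z _ a1 a2 a3
    obtain ⟨u, hu, h'⟩ := h x y z ((elt _ _ _).1 a1) ((elt _ _ _).1 a2) a3
    exact ⟨u, Finset.mem_univ _, (elt _ _ _).2 hu, h'⟩
  have eSFSP : ∀ σ ρ, IsSFSPlus A σ ρ → SFSProof.SFSP A Finset.univ (e σ) (e ρ) := by
    intro σ ρ h
    refine ⟨eSFS ρ h.1, ?_⟩
    intro y _ z _ a1 a2
    exact (elt _ _ _).2 (h.2 y z ((elt _ _ _).1 a1)
      (fun u hu => a2 u (Finset.mem_univ _) ((elt _ _ _).2 hu)))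
  obtain ⟨p, hp⟩ := hRob
  have hp' : SFSProof.Rob A Finset.univ (e p) := by
    refine ⟨einj p, ?_⟩
    intro x _ y _ z _ a1 a2
    exact le_min_iff.1 (hp x y z ((elt _ _ _).1 a1) ((elt _ _ _).1 a2))
  obtain ⟨h1s, a, haf, σ, hσ, hσl⟩ := h1
  obtain ⟨g, hg, hga⟩ := SFSProof.endAnchor hA' _ Finset.univ le_rfl (e p) (e σ) hp' (eSFS σ hσ) a
    (Finset.mem_univ _) (fun y _ => (ele _ _ _).2 (hσl y))
  have M := SFSProof.main hA' (n - 3) Finset.univ (by rw [Finset.card_univ, Fintype.card_fin]; omega)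
    (fun i => e (τ (i + 1))) (fun v => - g v) a (Finset.mem_univ _) (hg.neg hA')
    (fun y hy => by have := hga y hy; simpa using this) (eSFS _ h1s)
    (fun y _ => (ele _ _ _).2 (haf y))
    (fun i hi => eSFSP _ _ (hstep (i + 2) (by omega) (by omega)))
  have en : n - 3 + 1 = n - 2 := by omega
  simp only [en] at M
  intro x y z a1 a2
  exact le_min_iff.2 (M.2 x (Finset.mem_univ _) y (Finset.mem_univ _) z (Finset.mem_univ _)
    ((elt _ _ _).2 a1) ((elt _ _ _).2 a2))
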